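/- arXiv:1102.2350 — 2 statements merged into one kernel-verified Lean document; each statement's English description precedes it below -/
import Mathlib

section
/- If C is a linear [n,k;q] code (a k-dimensional subspace of F_q^n), then for all p ∈ [0, (q-1)/q], the probability of undetected error satisfies P_ue(C,p) ≤ (1-p)^{n-k} - (1-p)^n. -/
open scoped Classical

/-- Probability of undetected error on the q-ary symmetric channel:
`P_ue(C,p) = Σ_{c ∈ C, c ≠ 0} (p/(q-1))^{wt(c)} (1-p)^{n - wt(c)}`. -/
noncomputable def Pue {F : Type*} [Field F] [Fintype F] {n : ℕ}
    (C : Submodule F (Fin n → F)) (p : ℝ) : ℝ :=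
  ∑ c : C, if (c : Fin n → F) = 0 then 0 else
    (p / ((Fintype.card F : ℝ) - 1)) ^ hammingNorm (c : Fin n → F) *
      (1 - p) ^ (n - hammingNorm (c : Fin n → F))

/-- The weight of a single symbol: `b` if it is zero and `a` otherwise. -/
noncomputable def symbolWeight {F : Type*} [Zero F] (a b : ℝ) (x : F) : ℝ :=
  if x = 0 then b else a

lemma sum_symbolWeight {F : Type*} [Zero F] [Fintype F] (a b : ℝ) :
    ∑ x : F, symbolWeight a b x = b + ((Fintype.card F : ℝ) - 1) * a := by
  rw [← Finset.add_sum_erase _ _ (Finset.mem_univ (0 : F))]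
  congr 1
  · simp [symbolWeight]
  · rw [Finset.sum_congr rfl (g := fun _ => a) fun x hx => by
      simp [symbolWeight, Finset.ne_of_mem_erase hx]]
    rw [Finset.sum_const, Finset.card_erase_of_mem (Finset.mem_univ _), nsmul_eq_mul,
      Finset.card_univ, Nat.cast_sub (Fintype.card_pos_iff.2 ⟨(0 : F)⟩), Nat.cast_one]

lemma prod_symbolWeight {F : Type*} [Zero F] {n : ℕ} (a b : ℝ) (c : Fin n → F) :
    ∏ i, symbolWeight a b (c i) = a ^ hammingNorm c * b ^ (n - hammingNorm c) := by
  have hcard := Finset.card_filter_add_card_filter_not (s := Finset.univ) (fun i => c i = 0)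
  rw [Finset.card_univ, Fintype.card_fin] at hcard
  have hn : (Finset.univ.filter fun i => c i = 0).card = n - hammingNorm c := by
    unfold hammingNorm
    simp only [ne_eq]
    omega
  simp only [symbolWeight]
  rw [Finset.prod_ite, Finset.prod_const, Finset.prod_const, hn, mul_comm]
  rfl

lemma sum_pi_prod_symbolWeight {F κ : Type*} [Zero F] [Fintype F] [Fintype κ] [DecidableEq κ]
    (a b : ℝ) :
    ∑ y : κ → F, ∏ j, symbolWeight a b (y j) =
      (b + ((Fintype.card F : ℝ) - 1) * a) ^ Fintype.card κ := by
  have h := Finset.prod_univ_sum (fun _ : κ => (Finset.univ : Finset F))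
    (fun _ x => symbolWeight a b x)
  rw [Fintype.piFinset_univ] at h
  rw [← h, sum_symbolWeight, Finset.prod_const, Finset.card_univ]

/-- Some set of at most `dim C` coordinates determines every codeword. -/
lemma exists_injective_coordinates {F : Type*} [Field F] {n : ℕ}
    (C : Submodule F (Fin n → F)) :
    ∃ I : Finset (Fin n), I.card ≤ Module.finrank F C ∧
      Function.Injective fun (c : C) (i : I) => (c : Fin n → F) i := by
  let v : Fin n → Module.Dual F C := fun i => (LinearMap.proj i).comp C.subtype
  obtain ⟨κ, g, hg, hspan, hli⟩ := exists_linearIndependent' F v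
  have : Fintype κ := @Fintype.ofFinite κ (Finite.of_injective g hg)
  refine ⟨Finset.univ.image g, ?_, ?_⟩
  · calc _ ≤ Fintype.card κ := Finset.card_image_le
      _ ≤ Module.finrank F (Module.Dual F C) := hli.fintype_card_le_finrank
      _ = _ := Subspace.dual_finrank_eq
  · intro c d h
    have hle : Submodule.span F (Set.range (v ∘ g)) ≤
        LinearMap.ker (Module.Dual.eval F C (c - d)) := by
      rw [Submodule.span_le]
      rintro _ ⟨j, rfl⟩
      have hcoord := congrFun h ⟨g j, Finset.mem_image_of_mem g (Finset.mem_univ j)⟩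
      rw [SetLike.mem_coe, LinearMap.mem_ker, Module.Dual.eval_apply]
      simpa [v, sub_eq_zero] using hcoord
    ext i
    have hi := hle (hspan ▸ Submodule.subset_span (Set.mem_range_self i))
    simpa [v, sub_eq_zero] using hi

/-- The total weight of a code of dimension `k` is at most `b ^ (n - k)`. -/
lemma sum_prod_symbolWeight_le {F : Type*} [Field F] [Fintype F] {n : ℕ}
    (C : Submodule F (Fin n → F)) {a b : ℝ} (ha : 0 ≤ a) (hab : a ≤ b) (hb : b ≤ 1)
    (hsum : b + ((Fintype.card F : ℝ) - 1) * a = 1) :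
    ∑ c : C, ∏ i, symbolWeight a b ((c : Fin n → F) i) ≤ b ^ (n - Module.finrank F C) := by
  obtain ⟨I, hI, hinj⟩ := exists_injective_coordinates C
  have hb0 := ha.trans hab
  have hw0 (x : F) : 0 ≤ symbolWeight a b x := by
    unfold symbolWeight; split_ifs <;> assumption
  have hwb (x : F) : symbolWeight a b x ≤ b := by
    unfold symbolWeight; split_ifs <;> simp [hab]
  have hterm (c : C) : ∏ i, symbolWeight a b ((c : Fin n → F) i) ≤
      (∏ i : I, symbolWeight a b ((c : Fin n → F) i)) * b ^ (n - Module.finrank F C) := by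
    rw [← Finset.prod_mul_prod_compl I,
      Finset.prod_coe_sort I fun i => symbolWeight a b ((c : Fin n → F) i)]
    refine mul_le_mul_of_nonneg_left ?_ (Finset.prod_nonneg fun _ _ => hw0 _)
    calc _ ≤ ∏ _i ∈ Iᶜ, b := Finset.prod_le_prod (fun _ _ => hw0 _) fun _ _ => hwb _
      _ = b ^ (n - I.card) := by rw [Finset.prod_const, Finset.card_compl, Fintype.card_fin]
      _ ≤ _ := pow_le_pow_of_le_one hb0 hb (by omega)
  calc _ ≤ ∑ c : C, (∏ i : I, symbolWeight a b ((c : Fin n → F) i)) *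
        b ^ (n - Module.finrank F C) := Finset.sum_le_sum fun c _ => hterm c
    _ = (∑ c : C, ∏ i : I, symbolWeight a b ((c : Fin n → F) i)) *
        b ^ (n - Module.finrank F C) := by rw [Finset.sum_mul]
    _ ≤ 1 * b ^ (n - Module.finrank F C) := by
      refine mul_le_mul_of_nonneg_right ?_ (pow_nonneg hb0 _)
      calc _ = ∑ y ∈ Finset.univ.image (fun (c : C) (i : I) => (c : Fin n → F) i),
            ∏ i, symbolWeight a b (y i) := (Finset.sum_image hinj.injOn).symm
        _ ≤ ∑ y : I → F, ∏ i, symbolWeight a b (y i) :=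
          Finset.sum_le_sum_of_subset_of_nonneg (Finset.subset_univ _)
            fun _ _ _ => Finset.prod_nonneg fun _ _ => hw0 _
        _ = 1 := by rw [sum_pi_prod_symbolWeight, hsum, one_pow]
    _ = _ := one_mul _

lemma Pue_add_pow {F : Type*} [Field F] [Fintype F] {n : ℕ}
    (C : Submodule F (Fin n → F)) (p : ℝ) :
    Pue C p + (1 - p) ^ n = ∑ c : C, ∏ i,
      symbolWeight (p / ((Fintype.card F : ℝ) - 1)) (1 - p) ((c : Fin n → F) i) := by
  unfold Pue
  simp only [prod_symbolWeight]
  rw [← Finset.add_sum_erase _ _ (Finset.mem_univ (0 : C)),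
    ← Finset.add_sum_erase (Finset.univ : Finset C) (fun c => _ ^ hammingNorm (c : Fin n → F) * _)
      (Finset.mem_univ (0 : C)), add_right_comm]
  congr 1
  · simp
  · refine Finset.sum_congr rfl fun c hc => if_neg fun h => ?_
    exact Finset.ne_of_mem_erase hc (Subtype.ext h)

/-- If `C` is an `[n,k;q]` code, then for all `p ∈ [0,(q-1)/q]`,
`P_ue(C,p) ≤ (1-p)^{n-k} - (1-p)^n`. -/
theorem pue_le_general_bound {F : Type*} [Field F] [Fintype F] {n k q : ℕ}
    (hq : Fintype.card F = q) (hk : 1 ≤ k) (hkn : k ≤ n)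
    (C : Submodule F (Fin n → F)) (hdim : Module.finrank F C = k) :
    ∀ p : ℝ, 0 ≤ p → p ≤ ((q : ℝ) - 1) / q →
      Pue C p ≤ (1 - p) ^ (n - k) - (1 - p) ^ n := by
  intro p hp0 hp
  subst hq hdim
  have hq1 : (1 : ℝ) < Fintype.card F := by exact_mod_cast Fintype.one_lt_card
  have hqpos : (0 : ℝ) < Fintype.card F := by linarith
  have hq0 : (0 : ℝ) < (Fintype.card F : ℝ) - 1 := by linarith
  rw [le_div_iff₀ hqpos] at hp
  rw [le_sub_iff_add_le, Pue_add_pow]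
  refine sum_prod_symbolWeight_le C (div_nonneg hp0 hq0.le) ?_ (by linarith) ?_
  · rw [div_le_iff₀ hq0]
    linarith
  · field_simp
    ring
end

section
/- If C is a linear [n,k;q] code of full support (for every coordinate position i with 1 ≤ i ≤ n there exists a codeword of C that is nonzero in position i), then for all p ∈ [0, (q-1)/q], P_ue(C,p) ≤ (1-p)^{n-k+1} + (q-1)^{k-n} p^{n-k+1} - (1-p)^n. -/
open scoped Classical

section WeightSum

variable {F : Type*} [Field F]

/-- Prepending a zero coordinate. -/
def consZero (F : Type*) [Field F] (n : ℕ) : (Fin n → F) →ₗ[F] (Fin (n + 1) → F) where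
  toFun v := Fin.cons 0 v
  map_add' u v := by ext i; refine Fin.cases ?_ (fun j => ?_) i <;> simp
  map_smul' a v := by ext i; refine Fin.cases ?_ (fun j => ?_) i <;> simp

/-- Deleting the first coordinate. -/
def tailMap (F : Type*) [Field F] (n : ℕ) : (Fin (n + 1) → F) →ₗ[F] (Fin n → F) :=
  LinearMap.funLeft F F Fin.succ

/-- The code `C` shortened at its first coordinate. -/
def shortened {n : ℕ} (C : Submodule F (Fin (n + 1) → F)) : Submodule F (Fin n → F) :=
  C.comap (consZero F n)

/-- The code `C` punctured at its first coordinate. -/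
def punctured {n : ℕ} (C : Submodule F (Fin (n + 1) → F)) : Submodule F (Fin n → F) :=
  C.map (tailMap F n)

theorem mem_shortened {n : ℕ} {C : Submodule F (Fin (n + 1) → F)} {v : Fin n → F} :
    v ∈ shortened C ↔ (Fin.cons 0 v : Fin (n + 1) → F) ∈ C :=
  Iff.rfl

theorem mem_punctured {n : ℕ} {C : Submodule F (Fin (n + 1) → F)} {v : Fin n → F} :
    v ∈ punctured C ↔ ∃ a : F, (Fin.cons a v : Fin (n + 1) → F) ∈ C := by
  constructor
  · rintro ⟨c, hc, rfl⟩
    refine ⟨c 0, ?_⟩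
    change Fin.cons (c 0) (Fin.tail c) ∈ C
    rwa [Fin.cons_self_tail]
  · rintro ⟨a, ha⟩
    exact ⟨_, ha, by ext i; simp [tailMap, LinearMap.funLeft_apply]⟩

theorem finrank_punctured_le {n : ℕ} (C : Submodule F (Fin (n + 1) → F)) :
    Module.finrank F (punctured C) ≤ Module.finrank F C :=
  Submodule.finrank_map_le _ _

theorem finrank_shortened_lt {n : ℕ} {C : Submodule F (Fin (n + 1) → F)}
    (h : ∃ c ∈ C, c 0 ≠ 0) : Module.finrank F (shortened C) < Module.finrank F C := by
  have hinj : Function.Injective (consZero F n) := fun u v huv =>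
    Fin.cons_right_injective (α := fun _ => F) 0 huv
  have hmap : Module.finrank F ((shortened C).map (consZero F n)) =
      Module.finrank F (shortened C) :=
    (Submodule.equivMapOfInjective _ hinj _).finrank_eq.symm
  rw [← hmap]
  refine Submodule.finrank_lt_finrank_of_lt (lt_of_le_of_ne (Submodule.map_comap_le _ _) ?_)
  intro heq
  obtain ⟨c, hc, hc0⟩ := h
  rw [← heq] at hc
  obtain ⟨v, -, rfl⟩ := hc
  exact hc0 rfl

theorem cons_add_single {n : ℕ} (a b : F) (v : Fin n → F) :
    (Fin.cons a v : Fin (n + 1) → F) + Pi.single 0 b = Fin.cons (a + b) v := by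
  ext i; refine Fin.cases ?_ (fun j => ?_) i <;> simp

theorem cons_mem_of_single_mem {n : ℕ} {C : Submodule F (Fin (n + 1) → F)}
    (h : Pi.single 0 1 ∈ C) {a : F} (b : F) {v : Fin n → F}
    (ha : (Fin.cons a v : Fin (n + 1) → F) ∈ C) :
    (Fin.cons b v : Fin (n + 1) → F) ∈ C := by
  have h1 : (Pi.single 0 (b - a) : Fin (n + 1) → F) ∈ C := by
    have := C.smul_mem (b - a) h
    rwa [← Pi.single_smul, smul_eq_mul, mul_one] at this
  simpa [cons_add_single] using C.add_mem ha h1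

theorem cons_mem_unique {n : ℕ} {C : Submodule F (Fin (n + 1) → F)}
    (h : Pi.single 0 1 ∉ C) {a b : F} {v : Fin n → F}
    (ha : (Fin.cons a v : Fin (n + 1) → F) ∈ C)
    (hb : (Fin.cons b v : Fin (n + 1) → F) ∈ C) : a = b := by
  by_contra hab
  apply h
  have h1 := C.smul_mem (a - b)⁻¹ (C.sub_mem ha hb)
  convert h1 using 1
  ext i
  refine Fin.cases ?_ (fun j => ?_) i
  · simp [inv_mul_cancel₀ (sub_ne_zero.mpr hab)]
  · simp

theorem shortened_le_punctured {n : ℕ} (C : Submodule F (Fin (n + 1) → F)) :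
    shortened C ≤ punctured C := fun _ hv => mem_punctured.mpr ⟨0, hv⟩

theorem finrank_le_length {n : ℕ} (C : Submodule F (Fin n → F)) : Module.finrank F C ≤ n := by
  simpa using C.finrank_le

theorem prod_symbol_weights {n : ℕ} (v : Fin n → F) (x y : ℝ) :
    ∏ i, (if v i = 0 then y else x) = x ^ hammingNorm v * y ^ (n - hammingNorm v) := by
  have hcard := Finset.card_filter_add_card_filter_not (s := (Finset.univ : Finset (Fin n)))
    (fun i => v i = 0)
  rw [Finset.card_univ, Fintype.card_fin] at hcard
  have hnorm : hammingNorm v = (Finset.univ.filter fun i => ¬ v i = 0).card := rfl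
  rw [Finset.prod_ite, Finset.prod_const, Finset.prod_const, hnorm, mul_comm]
  congr 2
  omega

variable [Fintype F]

/-- The homogeneous weight enumerator of `C` evaluated at `(x, y)`, as a sum over the ambient
space. -/
noncomputable def weightSum {n : ℕ} (C : Submodule F (Fin n → F)) (x y : ℝ) : ℝ :=
  ∑ v : Fin n → F, if v ∈ C then ∏ i, (if v i = 0 then y else x) else 0

theorem weightSum_succ {n : ℕ} (C : Submodule F (Fin (n + 1) → F)) (x y : ℝ) :
    weightSum C x y = ∑ v : Fin n → F,
      (∑ a : F, if (Fin.cons a v : Fin (n + 1) → F) ∈ C then (if a = 0 then y else x) else 0) *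
        ∏ i, (if v i = 0 then y else x) := by
  unfold weightSum
  rw [← (Fin.consEquiv fun _ => F).sum_comp, Fintype.sum_prod_type_right]
  refine Finset.sum_congr rfl fun v _ => ?_
  rw [Finset.sum_mul]
  refine Finset.sum_congr rfl fun a _ => ?_
  change (if (Fin.cons a v : Fin (n + 1) → F) ∈ C then
    ∏ i, (if (Fin.cons a v : Fin (n + 1) → F) i = 0 then y else x) else 0) = _
  simp only [Fin.prod_univ_succ, Fin.cons_zero, Fin.cons_succ, ite_mul, zero_mul]

theorem sum_symbol_weights (x y : ℝ) :
    ∑ a : F, (if a = 0 then y else x) = y + ((Fintype.card F : ℝ) - 1) * x := by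
  have hsplit : ∀ a : F, (if a = 0 then y else x) = (if a = 0 then y - x else 0) + x := by
    intro a; split_ifs <;> ring
  simp only [hsplit, Finset.sum_add_distrib, Finset.sum_ite_eq', Finset.mem_univ, if_true,
    Finset.sum_const, Finset.card_univ, nsmul_eq_mul]
  ring

theorem weightSum_of_single_mem {n : ℕ} {C : Submodule F (Fin (n + 1) → F)}
    (h : Pi.single 0 1 ∈ C) {x y : ℝ} (hxy : y + ((Fintype.card F : ℝ) - 1) * x = 1) :
    weightSum C x y = weightSum (shortened C) x y := by
  rw [weightSum_succ]
  refine Finset.sum_congr rfl fun v _ => ?_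
  by_cases hv : v ∈ shortened C
  · have hall : ∀ a : F, (Fin.cons a v : Fin (n + 1) → F) ∈ C := fun a =>
      cons_mem_of_single_mem h a (mem_shortened.mp hv)
    simp only [hall, if_true, hv, sum_symbol_weights, hxy, one_mul]
  · have hnone : ∀ a : F, (Fin.cons a v : Fin (n + 1) → F) ∉ C := fun a ha =>
      hv (mem_shortened.mpr (cons_mem_of_single_mem h 0 ha))
    simp [hnone, hv]

theorem weightSum_of_single_notMem {n : ℕ} {C : Submodule F (Fin (n + 1) → F)}
    (h : Pi.single 0 1 ∉ C) (x y : ℝ) :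
    weightSum C x y =
      x * weightSum (punctured C) x y + (y - x) * weightSum (shortened C) x y := by
  rw [weightSum_succ]
  unfold weightSum
  rw [Finset.mul_sum, Finset.mul_sum, ← Finset.sum_add_distrib]
  refine Finset.sum_congr rfl fun v _ => ?_
  by_cases hv : v ∈ punctured C
  · obtain ⟨a, ha⟩ := mem_punctured.mp hv
    have hmem : ∀ b : F, (Fin.cons b v : Fin (n + 1) → F) ∈ C ↔ b = a := fun b =>
      ⟨fun hb => cons_mem_unique h hb ha, fun hb => hb ▸ ha⟩
    simp only [hmem, mem_shortened, hv, if_true, Finset.sum_ite_eq', Finset.mem_univ,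
      eq_comm (a := (0 : F)) (b := a)]
    split_ifs <;> ring
  · have hnone : ∀ a : F, (Fin.cons a v : Fin (n + 1) → F) ∉ C := fun a ha =>
      hv (mem_punctured.mpr ⟨a, ha⟩)
    simp [hnone, hv, mem_shortened]

theorem weightSum_mono {n : ℕ} {C D : Submodule F (Fin n → F)} (h : C ≤ D) {x y : ℝ}
    (hx : 0 ≤ x) (hy : 0 ≤ y) : weightSum C x y ≤ weightSum D x y := by
  refine Finset.sum_le_sum fun v _ => ?_
  have hprod : 0 ≤ ∏ i, (if v i = 0 then y else x) :=
    Finset.prod_nonneg fun i _ => by split_ifs <;> assumption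
  by_cases hv : v ∈ C
  · simp [hv, h hv]
  · rw [if_neg hv]
    split_ifs
    exacts [hprod, le_rfl]

theorem weightSum_le_pow {x y : ℝ} (hx : 0 ≤ x) (hxy : x ≤ y) (hy : y ≤ 1)
    (h1 : y + ((Fintype.card F : ℝ) - 1) * x = 1) :
    ∀ {n : ℕ} (C : Submodule F (Fin n → F)), weightSum C x y ≤ y ^ (n - Module.finrank F C) := by
  have hy0 : 0 ≤ y := hx.trans hxy
  intro n
  induction n with
  | zero =>
    intro C
    have hmem : ∀ v : Fin 0 → F, v ∈ C := fun v => Subsingleton.elim 0 v ▸ C.zero_mem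
    simp [weightSum, hmem]
  | succ n ih =>
    intro C
    by_cases h : Pi.single 0 1 ∈ C
    · rw [weightSum_of_single_mem h h1]
      refine (ih _).trans (pow_le_pow_of_le_one hy0 hy ?_)
      have := finrank_shortened_lt (C := C) ⟨_, h, by simp⟩
      omega
    · rw [weightSum_of_single_notMem h]
      have hle := weightSum_mono (shortened_le_punctured C) hx hy0
      calc x * weightSum (punctured C) x y + (y - x) * weightSum (shortened C) x y
          ≤ x * weightSum (punctured C) x y + (y - x) * weightSum (punctured C) x y := by
            gcongr
        _ = y * weightSum (punctured C) x y := by ring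
        _ ≤ y * y ^ (n - Module.finrank F (punctured C)) := by gcongr; exact ih _
        _ = y ^ (n - Module.finrank F (punctured C) + 1) := by ring
        _ ≤ y ^ (n + 1 - Module.finrank F C) := by
            refine pow_le_pow_of_le_one hy0 hy ?_
            have := finrank_punctured_le C
            omega

theorem weightSum_le_of_full_support {x y : ℝ} (hx : 0 ≤ x) (hxy : x ≤ y) (hy : y ≤ 1)
    (h1 : y + ((Fintype.card F : ℝ) - 1) * x = 1) :
    ∀ {n : ℕ} (C : Submodule F (Fin (n + 1) → F)), (∀ i, ∃ c ∈ C, c i ≠ 0) →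
      weightSum C x y ≤ y ^ (n + 1 - Module.finrank F C + 1) +
        ((Fintype.card F : ℝ) - 1) * x ^ (n + 1 - Module.finrank F C + 1) := by
  have hy0 : 0 ≤ y := hx.trans hxy
  have hx1 : x ≤ 1 := hxy.trans hy
  have hcard : (0 : ℝ) ≤ (Fintype.card F : ℝ) - 1 := by
    have : (1 : ℝ) ≤ Fintype.card F := by exact_mod_cast Fintype.card_pos (α := F)
    linarith
  intro n
  induction n with
  | zero =>
    intro C hC
    have hpos := finrank_shortened_lt (hC 0)
    have hrank : 0 + 1 - Module.finrank F C = 0 := by omega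
    have := weightSum_le_pow hx hxy hy h1 C
    rw [hrank, pow_zero] at this
    simpa only [hrank, zero_add, pow_one, h1] using this
  | succ n ih =>
    intro C hC
    have hlt := finrank_shortened_lt (hC 0)
    by_cases h : Pi.single 0 1 ∈ C
    · rw [weightSum_of_single_mem h h1]
      refine (ih _ fun i => ?_).trans ?_
      · obtain ⟨c, hc, hci⟩ := hC i.succ
        refine ⟨Fin.tail c, cons_mem_of_single_mem h (a := c 0) 0 ?_, hci⟩
        rwa [Fin.cons_self_tail]
      · have hexp : n + 1 + 1 - Module.finrank F C + 1 ≤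
            n + 1 - Module.finrank F (shortened C) + 1 := by omega
        exact add_le_add (pow_le_pow_of_le_one hy0 hy hexp)
          (mul_le_mul_of_nonneg_left (pow_le_pow_of_le_one hx hx1 hexp) hcard)
    · rw [weightSum_of_single_notMem h]
      set m := n + 1 + 1 - Module.finrank F C with hm
      have hrank := finrank_punctured_le C
      have hlen := finrank_le_length (punctured C)
      have hexp : m ≤ n + 1 - Module.finrank F (punctured C) + 1 := by omega
      have hpunct : weightSum (punctured C) x y ≤
          y ^ m + ((Fintype.card F : ℝ) - 1) * x ^ m := by
        refine (ih _ fun i => ?_).trans <| add_le_add (pow_le_pow_of_le_one hy0 hy hexp)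
          (mul_le_mul_of_nonneg_left (pow_le_pow_of_le_one hx hx1 hexp) hcard)
        obtain ⟨c, hc, hci⟩ := hC i.succ
        exact ⟨_, Submodule.mem_map_of_mem hc, hci⟩
      have hshort : weightSum (shortened C) x y ≤ y ^ m :=
        (weightSum_le_pow hx hxy hy h1 _).trans (pow_le_pow_of_le_one hy0 hy (by omega))
      have e1 := mul_le_mul_of_nonneg_left hpunct hx
      have e2 := mul_le_mul_of_nonneg_left hshort (sub_nonneg.mpr hxy)
      calc _ ≤ _ := add_le_add e1 e2
        _ = _ := by ring

theorem Pue_eq_weightSum_sub {n : ℕ} (C : Submodule F (Fin n → F)) (p : ℝ) :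
    Pue C p = weightSum C (p / ((Fintype.card F : ℝ) - 1)) (1 - p) - (1 - p) ^ n := by
  set x := p / ((Fintype.card F : ℝ) - 1)
  have hsum : weightSum C x (1 - p) =
      ∑ c : C, x ^ hammingNorm (c : Fin n → F) *
        (1 - p) ^ (n - hammingNorm (c : Fin n → F)) := by
    simp only [weightSum, prod_symbol_weights]
    rw [← Finset.sum_filter]
    exact Finset.sum_subtype _ (by simp) _
  rw [hsum, eq_sub_iff_add_eq, Pue, ← Finset.add_sum_erase _ _ (Finset.mem_univ (0 : C)),
    ← Finset.add_sum_erase (a := (0 : C)) _ _ (Finset.mem_univ _)]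
  have hrest : ∀ c ∈ (Finset.univ : Finset C).erase 0, (c : Fin n → F) ≠ 0 := fun c hc h0 =>
    (Finset.mem_erase.mp hc).1 (Subtype.ext h0)
  rw [Finset.sum_congr rfl fun c hc => if_neg (hrest c hc)]
  simp [add_comm, x]

end WeightSum

/-- If `C` is an `[n,k;q]` code of full support, then for all `p ∈ [0,(q-1)/q]`,
`P_ue(C,p) ≤ (1-p)^{n-k+1} + (q-1)^{k-n} p^{n-k+1} - (1-p)^n`. -/
theorem pue_le_full_support_bound {F : Type*} [Field F] [Fintype F] {n k q : ℕ}
    (hq : Fintype.card F = q) (hk : 1 ≤ k) (hkn : k ≤ n)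
    (C : Submodule F (Fin n → F)) (hdim : Module.finrank F C = k)
    (hfull : ∀ i : Fin n, ∃ c ∈ C, c i ≠ 0) :
    ∀ p : ℝ, 0 ≤ p → p ≤ ((q : ℝ) - 1) / q →
      Pue C p ≤ (1 - p) ^ (n - k + 1) +
        ((q : ℝ) - 1) ^ ((k : ℤ) - (n : ℤ)) * p ^ (n - k + 1) - (1 - p) ^ n := by
  subst hq hdim
  intro p hp0 hp
  obtain ⟨m, rfl⟩ : ∃ m, n = m + 1 := ⟨n - 1, by omega⟩
  have hcard : (1 : ℝ) < Fintype.card F := by exact_mod_cast Fintype.one_lt_card (α := F)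
  have hq1 : (0 : ℝ) < (Fintype.card F : ℝ) - 1 := sub_pos.mpr hcard
  rw [le_div_iff₀ (by linarith)] at hp
  have hmul : ((Fintype.card F : ℝ) - 1) * (p / ((Fintype.card F : ℝ) - 1)) = p :=
    mul_div_cancel₀ p hq1.ne'
  have hbound := weightSum_le_of_full_support (x := p / ((Fintype.card F : ℝ) - 1)) (y := 1 - p)
    (div_nonneg hp0 hq1.le) (by rw [div_le_iff₀ hq1]; linarith) (by linarith)
    (by rw [hmul]; ring) C hfull
  have hterm : ((Fintype.card F : ℝ) - 1) *
        (p / ((Fintype.card F : ℝ) - 1)) ^ (m + 1 - Module.finrank F C + 1) =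
      ((Fintype.card F : ℝ) - 1) ^ ((Module.finrank F C : ℤ) - ((m + 1 : ℕ) : ℤ)) *
        p ^ (m + 1 - Module.finrank F C + 1) := by
    have hz : (Module.finrank F C : ℤ) - ((m + 1 : ℕ) : ℤ) =
        -((m + 1 - Module.finrank F C : ℕ) : ℤ) := by omega
    rw [hz, zpow_neg, zpow_natCast, div_pow, pow_succ ((Fintype.card F : ℝ) - 1)]
    field_simp
  rw [hterm] at hbound
  rw [Pue_eq_weightSum_sub]
  linarith
end
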